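/- Let n ≥ 2, β ∈ (0,1] and α ∈ (0,β). Let Ω : ℝ^n∖{0} → ℝ be homogeneous of degree zero with |Ω(z)−Ω(w)| ≤ L|z−w|^β and |Ω(z)| ≤ M for all unit vectors z, w. Let a : ℝ^n → ℝ be measurable with supp a ⊆ B(x₀,r), |a(y)| ≤ A for a.e. y, and ∫_{ℝ^n} a(y) dy = 0. Then there exists C = C(n,α,β) > 0 such that for every x with |x−x₀| ≥ 2r, one has |T_{Ω,α} a(x)| ≤ C (L+M) A r^{n+β} |x−x₀|^{α−n−β}. -/

import Mathlib

open MeasureTheory Metric Filter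
open scoped ENNReal NNReal Topology

noncomputable section

abbrev En (n : ℕ) := EuclideanSpace ℝ (Fin n)

/-- Extended Musielak--Orlicz quasinorm over a set `A`, for `ℝ≥0∞`-valued functions. -/
def eMOnormOn {n : ℕ} (φ : En n → ℝ → ℝ) (A : Set (En n)) (f : En n → ℝ≥0∞) : ℝ≥0∞ :=
  sInf {l : ℝ≥0∞ | 0 < l ∧
    (∫⁻ x in A, (if f x = ⊤ then (⊤ : ℝ≥0∞)
      else ENNReal.ofReal (φ x ((f x).toReal / l.toReal)))) ≤ 1}

/-- Musielak--Orlicz quasinorm `‖f‖_{L^φ(A)}`. -/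
def MOnormOn {n : ℕ} (φ : En n → ℝ → ℝ) (A : Set (En n)) (f : En n → ℝ) : ℝ≥0∞ :=
  eMOnormOn φ A fun x => ENNReal.ofReal |f x|

/-- Musielak--Orlicz quasinorm `‖f‖_{L^φ(ℝ^n)}`. -/
def MOnorm {n : ℕ} (φ : En n → ℝ → ℝ) (f : En n → ℝ) : ℝ≥0∞ :=
  MOnormOn φ Set.univ f

/-- `‖χ_s‖_{L^φ(ℝ^n)}`. -/
def chiNorm {n : ℕ} (φ : En n → ℝ → ℝ) (s : Set (En n)) : ℝ≥0∞ :=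
  MOnorm φ (s.indicator fun _ => (1 : ℝ))

/-- `b_B`, the average of `b` over the ball `B(x₀,r)`. -/
def ballAvg {n : ℕ} (b : En n → ℝ) (x₀ : En n) (r : ℝ) : ℝ :=
  ⨍ x in ball x₀ r, b x

/-- The classical BMO seminorm, as an `ℝ≥0∞`-valued supremum over all balls. -/
def bmoNorm {n : ℕ} (b : En n → ℝ) : ℝ≥0∞ :=
  ⨆ (x₀ : En n) (r : ℝ) (_ : 0 < r),
    ENNReal.ofReal (⨍ x in ball x₀ r, |b x - ballAvg b x₀ r|)

/-- `‖ |·−x₀|^{−n} ‖_{L^φ(B(x₀,r)^c)}`. -/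
def kerNorm {n : ℕ} (φ : En n → ℝ → ℝ) (x₀ : En n) (r : ℝ) : ℝ≥0∞ :=
  MOnormOn φ (ball x₀ r)ᶜ fun x => ‖x - x₀‖ ^ (-(n : ℝ))

/-- The `𝓑𝓜𝓞_φ = 𝓑𝓜𝓞_{φ,∞}` norm. -/
def bmoPhiNorm {n : ℕ} (φ : En n → ℝ → ℝ) (b : En n → ℝ) : ℝ≥0∞ :=
  ⨆ (x₀ : En n) (r : ℝ) (_ : 0 < r),
    (chiNorm φ (ball x₀ r))⁻¹ *
      (∫⁻ x in ball x₀ r, ENNReal.ofReal |b x - ballAvg b x₀ r|) * kerNorm φ x₀ r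

/-- The `𝓑𝓜𝓞_{φ,u}` norm, `1 < u < ∞`, with conjugate exponent `u' = u/(u-1)`. -/
def bmoPhiUNorm {n : ℕ} (φ : En n → ℝ → ℝ) (u : ℝ) (b : En n → ℝ) : ℝ≥0∞ :=
  ⨆ (x₀ : En n) (r : ℝ) (_ : 0 < r),
    ENNReal.ofReal ((volume (ball x₀ r)).toReal ^ (1 / u)) *
      (chiNorm φ (ball x₀ r))⁻¹ *
      (∫⁻ x in ball x₀ r,
          ENNReal.ofReal (|b x - ballAvg b x₀ r| ^ (u / (u - 1)))) ^ (1 - 1 / u) *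
      kerNorm φ x₀ r

/-- Musielak--Orlicz function: `φ(x,·)` is an Orlicz function for each `x`, and
`φ(·,t)` is measurable for each `t`. -/
structure IsMOFun {n : ℕ} (φ : En n → ℝ → ℝ) : Prop where
  nonneg : ∀ x t, 0 ≤ φ x t
  mono : ∀ x, MonotoneOn (φ x) (Set.Ici (0 : ℝ))
  zero : ∀ x, φ x 0 = 0
  pos : ∀ x t, 0 < t → 0 < φ x t
  tends : ∀ x, Tendsto (φ x) atTop atTop
  meas : ∀ t, Measurable fun x => φ x t

/-- Uniformly lower type `p`. -/
def UnifLowerType {n : ℕ} (φ : En n → ℝ → ℝ) (p : ℝ) : Prop :=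
  ∃ C > 0, ∀ x t s, 0 ≤ t → s ∈ Set.Ioc (0 : ℝ) 1 → φ x (s * t) ≤ C * s ^ p * φ x t

/-- Uniformly upper type `p`. -/
def UnifUpperType {n : ℕ} (φ : En n → ℝ → ℝ) (p : ℝ) : Prop :=
  ∃ C > 0, ∀ x t s, 0 ≤ t → 1 ≤ s → φ x (s * t) ≤ C * s ^ p * φ x t

open Classical in
/-- The uniformly Muckenhoupt condition `𝔸_q`, `q ∈ [1,∞)`. -/
def UniformA {n : ℕ} (q : ℝ) (φ : En n → ℝ → ℝ) : Prop :=
  ∃ C > 0, ∀ (x₀ : En n) (r t : ℝ), 0 < r → 0 < t →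
    if q = 1 then
      ∀ᵐ y ∂(volume.restrict (ball x₀ r)), (⨍ x in ball x₀ r, φ x t) ≤ C * φ y t
    else
      (⨍ x in ball x₀ r, φ x t) *
        (⨍ x in ball x₀ r, φ x t ^ (-(1 / (q - 1)))) ^ (q - 1) ≤ C

/-- The uniformly reverse Hölder condition `ℝℍ_r`, `r ∈ (1,∞)`. -/
def UniformRH {n : ℕ} (r : ℝ) (φ : En n → ℝ → ℝ) : Prop :=
  ∃ C > 0, ∀ (x₀ : En n) (ρ t : ℝ), 0 < ρ → 0 < t →
    (⨍ x in ball x₀ ρ, φ x t ^ r) ^ (1 / r) ≤ C * ⨍ x in ball x₀ ρ, φ x t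

/-- The uniformly reverse Hölder condition `ℝℍ_∞`. -/
def UniformRHInf {n : ℕ} (φ : En n → ℝ → ℝ) : Prop :=
  ∃ C > 0, ∀ (x₀ : En n) (ρ t : ℝ), 0 < ρ → 0 < t →
    ∀ᵐ y ∂(volume.restrict (ball x₀ ρ)), φ y t ≤ C * ⨍ x in ball x₀ ρ, φ x t

/-- Growth function: a Musielak--Orlicz function of uniformly lower type `p` for some
`p ∈ (0,1]`, of uniformly upper type `1`, satisfying `𝔸_q` for some `q ∈ [1,∞)`. -/
def IsGrowthFun {n : ℕ} (φ : En n → ℝ → ℝ) : Prop :=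
  IsMOFun φ ∧ (∃ p, p ∈ Set.Ioc (0 : ℝ) 1 ∧ UnifLowerType φ p) ∧
    UnifUpperType φ 1 ∧ ∃ q, 1 ≤ q ∧ UniformA q φ

/-- The Riesz potential `I_α f(x) = ∫ f(y) |x−y|^{α−n} dy`. -/
def rieszPot {n : ℕ} (α : ℝ) (f : En n → ℝ) (x : En n) : ℝ :=
  ∫ y, f y * ‖x - y‖ ^ (α - (n : ℝ))

/-- The commutator `[b, I_α] f(x) = ∫ (b(x)−b(y)) |x−y|^{α−n} f(y) dy`. -/
def commRiesz {n : ℕ} (α : ℝ) (b f : En n → ℝ) (x : En n) : ℝ :=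
  ∫ y, (b x - b y) * ‖x - y‖ ^ (α - (n : ℝ)) * f y

/-- The fractional integral with homogeneous kernel `T_{Ω,α}`. -/
def TOmega {n : ℕ} (Ω : En n → ℝ) (α : ℝ) (f : En n → ℝ) (x : En n) : ℝ :=
  ∫ y, Ω (x - y) * ‖x - y‖ ^ (α - (n : ℝ)) * f y

/-- The commutator `[b, T_{Ω,α}]`. -/
def commTOmega {n : ℕ} (Ω : En n → ℝ) (α : ℝ) (b f : En n → ℝ) (x : En n) : ℝ :=
  ∫ y, (b x - b y) * Ω (x - y) * ‖x - y‖ ^ (α - (n : ℝ)) * f y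

/-- The smooth maximal function `M_Φ g(x) = sup_{t>0} |∫ g(y) t^{−n} Φ((x−y)/t) dy|`. -/
def maxFn {n : ℕ} (Φ : En n → ℝ) (g : En n → ℝ) (x : En n) : ℝ≥0∞ :=
  ⨆ (t : ℝ) (_ : 0 < t),
    ENNReal.ofReal |∫ y, g y * t ^ (-(n : ℝ)) * Φ (t⁻¹ • (x - y))|

/-- The `L^q_φ(B(x₀,ρ))` norm `sup_{t>0} ((1/φ(B,t)) ∫_B |f|^q φ(·,t))^{1/q}`. -/
def LqPhiNorm {n : ℕ} (φ : En n → ℝ → ℝ) (x₀ : En n) (ρ q : ℝ) (f : En n → ℝ) : ℝ≥0∞ :=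
  ⨆ (t : ℝ) (_ : 0 < t),
    ((∫⁻ x in ball x₀ ρ, ENNReal.ofReal (|f x| ^ q * φ x t)) /
      ∫⁻ x in ball x₀ ρ, ENNReal.ofReal (φ x t)) ^ (1 / q)

/-- `(H^φ,∞)`-atom related to the ball `B(x₀,ρ)`. -/
def IsAtomInf {n : ℕ} (φ : En n → ℝ → ℝ) (x₀ : En n) (ρ : ℝ) (a : En n → ℝ) : Prop :=
  Function.support a ⊆ ball x₀ ρ ∧
    (∀ x, ENNReal.ofReal |a x| ≤ (chiNorm φ (ball x₀ ρ))⁻¹) ∧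
    Integrable a ∧ (∫ x, a x) = 0

/-- `(H^φ,q)`-atom related to the ball `B(x₀,ρ)`. -/
def IsAtomQ {n : ℕ} (φ : En n → ℝ → ℝ) (x₀ : En n) (ρ q : ℝ) (a : En n → ℝ) : Prop :=
  Measurable a ∧ Function.support a ⊆ ball x₀ ρ ∧
    LqPhiNorm φ x₀ ρ q a ≤ (chiNorm φ (ball x₀ ρ))⁻¹ ∧
    Integrable a ∧ (∫ x, a x) = 0

/-- Normalization to the unit sphere is Lipschitz away from the origin. -/
lemma norm_normalize_sub_normalize_le {E : Type*} [NormedAddCommGroup E] [NormedSpace ℝ E]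
    {u v : E} (hu : u ≠ 0) (hv : v ≠ 0) :
    ‖‖v‖⁻¹ • v - ‖u‖⁻¹ • u‖ ≤ 2 * ‖v - u‖ / ‖u‖ := by
  have hu' : 0 < ‖u‖ := norm_pos_iff.2 hu
  have hv' : 0 < ‖v‖ := norm_pos_iff.2 hv
  have h : ‖v‖⁻¹ • v - ‖u‖⁻¹ • u = ‖u‖⁻¹ • (v - u) + (‖v‖⁻¹ - ‖u‖⁻¹) • v := by
    rw [smul_sub, sub_smul]; abel
  have h2 : ‖(‖v‖⁻¹ - ‖u‖⁻¹) • v‖ = |‖u‖ - ‖v‖| / ‖u‖ := by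
    rw [norm_smul, Real.norm_eq_abs, inv_sub_inv hv'.ne' hu'.ne', abs_div, abs_mul,
      abs_of_pos hu', abs_of_pos hv']
    field_simp
  have h3 : |‖u‖ - ‖v‖| ≤ ‖v - u‖ := by
    rw [norm_sub_rev]; exact abs_norm_sub_norm_le u v
  calc ‖‖v‖⁻¹ • v - ‖u‖⁻¹ • u‖ ≤ ‖u‖⁻¹ * ‖v - u‖ + |‖u‖ - ‖v‖| / ‖u‖ := by
        rw [h, ← h2]
        refine (norm_add_le _ _).trans_eq ?_
        rw [norm_smul ‖u‖⁻¹, norm_inv, norm_norm]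
    _ ≤ ‖u‖⁻¹ * ‖v - u‖ + ‖v - u‖ / ‖u‖ := by gcongr
    _ = 2 * ‖v - u‖ / ‖u‖ := by ring

/-- Lipschitz bound for a decreasing power on `[t/2, ∞)`. -/
lemma abs_rpow_sub_rpow_le {γ s t : ℝ} (hγ : γ ≤ 0) (ht : 0 < t) (hs : t / 2 ≤ s) :
    |s ^ γ - t ^ γ| ≤ |γ| * (t / 2) ^ (γ - 1) * |s - t| := by
  have hpos : ∀ y ∈ Set.Ici (t / 2), 0 < y := fun y hy => (half_pos ht).trans_le hy
  refine (convex_Ici (t / 2)).norm_image_sub_le_of_norm_hasDerivWithin_le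
    (f := fun y : ℝ => y ^ γ) (f' := fun y => γ * y ^ (γ - 1)) (fun y hy => ?_) (fun y hy => ?_)
    (half_le_self ht.le) hs
  · exact (Real.hasDerivAt_rpow_const (Or.inl (hpos y hy).ne')).hasDerivWithinAt
  · rw [norm_mul, Real.norm_eq_abs, Real.norm_of_nonneg (Real.rpow_nonneg (hpos y hy).le _)]
    gcongr ?_ * ?_
    exact Real.rpow_le_rpow_of_nonpos (half_pos ht) hy (by linarith)

/-- Hölder-type regularity of the kernel `Ω(z)|z|^γ` for `γ ≤ 0`. -/
lemma abs_homogeneous_kernel_sub_le {E : Type*} [NormedAddCommGroup E] [NormedSpace ℝ E]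
    {β γ L M r : ℝ} (hβ : β ∈ Set.Ioc (0 : ℝ) 1) (hγ : γ ≤ 0) (hL : 0 ≤ L) (hM : 0 ≤ M)
    {Ω : E → ℝ} (hom : ∀ c : ℝ, 0 < c → ∀ z : E, z ≠ 0 → Ω (c • z) = Ω z)
    (hlip : ∀ z w : E, ‖z‖ = 1 → ‖w‖ = 1 → |Ω z - Ω w| ≤ L * ‖z - w‖ ^ β)
    (hbdd : ∀ z : E, ‖z‖ = 1 → |Ω z| ≤ M) (hr : 0 < r) {u v : E} (hu : 2 * r ≤ ‖u‖)
    (huv : ‖v - u‖ ≤ r) :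
    |Ω v * ‖v‖ ^ γ - Ω u * ‖u‖ ^ γ| ≤
      (2 ^ β * (1 / 2) ^ γ + |γ| * (1 / 2) ^ (γ - 1)) * (L + M) * r ^ β * ‖u‖ ^ (γ - β) := by
  have hu0 : 0 < ‖u‖ := by linarith
  have hvu : ‖u‖ / 2 ≤ ‖v‖ := by
    have := norm_sub_norm_le u v
    rw [norm_sub_rev] at this
    linarith
  have hv0 : 0 < ‖v‖ := (half_pos hu0).trans_le hvu
  have hune : u ≠ 0 := norm_pos_iff.1 hu0
  have hvne : v ≠ 0 := norm_pos_iff.1 hv0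
  have nu : ‖‖u‖⁻¹ • u‖ = 1 := by rw [norm_smul, norm_inv, norm_norm, inv_mul_cancel₀ hu0.ne']
  have nv : ‖‖v‖⁻¹ • v‖ = 1 := by rw [norm_smul, norm_inv, norm_norm, inv_mul_cancel₀ hv0.ne']
  have eu := hom _ (inv_pos.2 hu0) u hune
  have ev := hom _ (inv_pos.2 hv0) v hvne
  have hΩu : |Ω u| ≤ M := eu ▸ hbdd _ nu
  have hΩ : |Ω v - Ω u| ≤ L * (2 * (r / ‖u‖)) ^ β := by
    have h := hlip _ _ nv nu
    rw [eu, ev] at h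
    refine h.trans ?_
    gcongr
    · exact hβ.1.le
    · refine (norm_normalize_sub_normalize_le hune hvne).trans ?_
      rw [mul_div_assoc]
      gcongr
  have hvγ : ‖v‖ ^ γ ≤ (1 / 2) ^ γ * ‖u‖ ^ γ := by
    rw [← Real.mul_rpow (by norm_num) hu0.le]
    exact Real.rpow_le_rpow_of_nonpos (by positivity) (by linarith) hγ
  have hpow : |‖v‖ ^ γ - ‖u‖ ^ γ| ≤ |γ| * (1 / 2) ^ (γ - 1) * ‖u‖ ^ γ * (r / ‖u‖) ^ β := by
    have h1 : r / ‖u‖ ≤ (r / ‖u‖) ^ β :=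
      Real.self_le_rpow_of_le_one (by positivity) ((div_le_one hu0).2 (by linarith)) hβ.2
    calc |‖v‖ ^ γ - ‖u‖ ^ γ| ≤ |γ| * (‖u‖ / 2) ^ (γ - 1) * |‖v‖ - ‖u‖| :=
          abs_rpow_sub_rpow_le hγ hu0 hvu
      _ ≤ |γ| * (‖u‖ / 2) ^ (γ - 1) * r := by
          gcongr
          exact (abs_norm_sub_norm_le v u).trans huv
      _ = |γ| * (1 / 2) ^ (γ - 1) * ‖u‖ ^ γ * (r / ‖u‖) := by
          rw [div_eq_mul_one_div, Real.mul_rpow hu0.le (by norm_num), Real.rpow_sub_one hu0.ne']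
          field_simp
      _ ≤ _ := by gcongr
  have hsplit : (r / ‖u‖) ^ β * ‖u‖ ^ γ = r ^ β * ‖u‖ ^ (γ - β) := by
    rw [Real.div_rpow hr.le hu0.le, Real.rpow_sub hu0]
    ring
  calc |Ω v * ‖v‖ ^ γ - Ω u * ‖u‖ ^ γ|
      = |(Ω v - Ω u) * ‖v‖ ^ γ + Ω u * (‖v‖ ^ γ - ‖u‖ ^ γ)| := by ring_nf
    _ ≤ |Ω v - Ω u| * ‖v‖ ^ γ + |Ω u| * |‖v‖ ^ γ - ‖u‖ ^ γ| := by
        refine (abs_add_le _ _).trans_eq ?_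
        rw [abs_mul, abs_mul, abs_of_nonneg (Real.rpow_nonneg hv0.le γ)]
    _ ≤ L * (2 * (r / ‖u‖)) ^ β * ((1 / 2) ^ γ * ‖u‖ ^ γ) +
          M * (|γ| * (1 / 2) ^ (γ - 1) * ‖u‖ ^ γ * (r / ‖u‖) ^ β) := by gcongr
    _ = (2 ^ β * (1 / 2) ^ γ * L + |γ| * (1 / 2) ^ (γ - 1) * M) *
          ((r / ‖u‖) ^ β * ‖u‖ ^ γ) := by
        rw [Real.mul_rpow (by norm_num) (by positivity)]; ring
    _ ≤ (2 ^ β * (1 / 2) ^ γ * (L + M) + |γ| * (1 / 2) ^ (γ - 1) * (L + M)) *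
          ((r / ‖u‖) ^ β * ‖u‖ ^ γ) := by
        gcongr <;> linarith
    _ = _ := by rw [hsplit]; ring

/-- decay estimate for `T_{Ω,α} a` for a bounded, compactly supported `a`
with vanishing integral. -/
theorem stmt4 (n : ℕ) (hn : 2 ≤ n) (β α : ℝ) (hβ : β ∈ Set.Ioc (0 : ℝ) 1)
    (hα : α ∈ Set.Ioo (0 : ℝ) β) :
    ∃ C > 0, ∀ (Ω : En n → ℝ) (L M : ℝ), 0 ≤ L → 0 ≤ M → Measurable Ω →
      (∀ c : ℝ, 0 < c → ∀ z : En n, z ≠ 0 → Ω (c • z) = Ω z) →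
      (∀ z w : En n, ‖z‖ = 1 → ‖w‖ = 1 → |Ω z - Ω w| ≤ L * ‖z - w‖ ^ β) →
      (∀ z : En n, ‖z‖ = 1 → |Ω z| ≤ M) →
      ∀ (A r : ℝ) (x₀ : En n) (a : En n → ℝ), 0 ≤ A → 0 < r →
        Measurable a → Function.support a ⊆ ball x₀ r →
        (∀ᵐ y ∂(volume : Measure (En n)), |a y| ≤ A) →
        Integrable a → (∫ y, a y) = 0 →
        ∀ x : En n, 2 * r ≤ ‖x - x₀‖ →
          |TOmega Ω α a x| ≤
            C * (L + M) * A * r ^ ((n : ℝ) + β) * ‖x - x₀‖ ^ (α - (n : ℝ) - β) := by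
  set γ : ℝ := α - n with hγdef
  have hn' : (2 : ℝ) ≤ n := by exact_mod_cast hn
  have hγ : γ ≤ 0 := by linarith [hα.2, hβ.2]
  set D : ℝ := 2 ^ β * (1 / 2) ^ γ + |γ| * (1 / 2) ^ (γ - 1)
  have hD0 : 0 < D := by positivity
  set V : ℝ := volume.real (ball (0 : En n) 1) with hV
  have hV0 : 0 < V := ENNReal.toReal_pos (measure_ball_pos _ _ one_pos).ne' measure_ball_lt_top.ne
  refine ⟨D * V, by positivity, ?_⟩
  intro Ω L M hL hM hΩm hom hlip hbdd A r x₀ a hA hr ham hsupp haA haint ha0 x hx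
  set B : ℝ := D * (L + M) * r ^ β * ‖x - x₀‖ ^ (γ - β) with hB
  have hB0 : 0 ≤ B := by positivity
  set f : En n → ℝ := fun y =>
    (Ω (x - y) * ‖x - y‖ ^ γ - Ω (x - x₀) * ‖x - x₀‖ ^ γ) * a y with hf
  have hbound : ∀ᵐ y, ‖f y‖ ≤ (ball x₀ r).indicator (fun _ => B * A) y := by
    filter_upwards [haA] with y hy
    by_cases hyb : y ∈ ball x₀ r
    · rw [Set.indicator_of_mem hyb, norm_mul]
      gcongr
      · refine abs_homogeneous_kernel_sub_le hβ hγ hL hM hom hlip hbdd hr hx ?_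
        rw [sub_sub_sub_cancel_left, norm_sub_rev]
        exact (mem_ball_iff_norm.1 hyb).le
      · exact hy
    · have : a y = 0 := by
        by_contra h
        exact hyb (hsupp h)
      simp [f, this, hyb]
  have hgint : Integrable ((ball x₀ r).indicator fun _ : En n => B * A) :=
    (integrable_indicator_iff measurableSet_ball).2
      (integrableOn_const measure_ball_lt_top.ne)
  have hfint : Integrable f := by
    refine hgint.mono' (Measurable.aestronglyMeasurable ?_) hbound
    fun_prop
  have hT : TOmega Ω α a x = ∫ y, f y := by
    have : ∀ y, Ω (x - y) * ‖x - y‖ ^ γ * a y =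
        f y + Ω (x - x₀) * ‖x - x₀‖ ^ γ * a y := fun y => by simp only [hf]; ring
    simp only [TOmega, ← hγdef, this]
    rw [integral_add hfint (haint.const_mul _), integral_const_mul, ha0, mul_zero, add_zero]
  have hvol : volume.real (ball x₀ r) = r ^ (n : ℝ) * V := by
    rw [measureReal_def, Measure.addHaar_ball_of_pos _ _ hr, finrank_euclideanSpace_fin,
      ENNReal.toReal_mul, ENNReal.toReal_ofReal (by positivity), Real.rpow_natCast, hV,
      measureReal_def]
  calc |TOmega Ω α a x| ≤ ∫ y, (ball x₀ r).indicator (fun _ : En n => B * A) y := by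
        rw [hT]
        exact norm_integral_le_of_norm_le hgint hbound
    _ = r ^ (n : ℝ) * V * (B * A) := by
        rw [integral_indicator_const _ measurableSet_ball, hvol, smul_eq_mul]
    _ = _ := by
        rw [Real.rpow_add hr, hB]; ring
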